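/- Let ε > 0, let φ and B be C^∞ functions on [0,ε), let λ ≥ 0 and c₀ > 0, and assume φ(x) > 0 and λφ(x) + B(x) ≥ c₀ for all x ∈ [0,ε). There exist T₀ ∈ (0, ε/2] and C > 0, depending only on φ, B, λ, c₀, with the following property. Let 0 < T ≤ T₀, let G be measurable on Ω_T = (0,T)×(0,T) with |||G|||_{0,5/2} < ∞ and |||G|||_{0,2} < ∞, and let W be a C^∞ function on Ω_T satisfying (μ+ν)² ∂_μ∂_ν W − (λ φ(2μν/(μ+ν)) + B(2μν/(μ+ν))) W = G on Ω_T, whose diagonal traces q₁(μ) = W(μ,μ) and q₂(μ) = (∂_μ W)(μ,μ) satisfy ‖q₁‖_{2,2} < ∞ and ‖q₂‖_{2,2} < ∞. Then ∫_{Ω_T} (μ+ν)^{-4} (λ+1) W² dμ dν ≤ C (‖q₁‖_{2,2}² + ‖q₂‖_{2,2}² + |||G|||_{0,5/2}² + |||G|||_{0,2}²). -/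

import Mathlib

open MeasureTheory Set ENNReal

/-- The weighted Sobolev norm squared
`‖q‖_{s,j}² = Σ_{i=0}^{s} ∫_0^T |(d/dμ)^i (μ^{-j} q(μ))|² dμ`, valued in `[0,∞]`. -/
noncomputable def sobNormSq (T : ℝ) (s : ℕ) (j : ℝ) (q : ℝ → ℝ) : ℝ≥0∞ :=
  ∑ i ∈ Finset.range (s + 1),
    ∫⁻ μ in Ioo (0 : ℝ) T, ENNReal.ofReal ((iteratedDeriv i (fun t => t ^ (-j) * q t) μ) ^ 2)

/-- The weighted norm squared `|||G|||_{0,j}² = ∫_{Ω_T} (μ+ν)^{-2j} G(μ,ν)² dμ dν`,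
valued in `[0,∞]`. -/
noncomputable def srcNormSq (T : ℝ) (j : ℝ) (G : ℝ → ℝ → ℝ) : ℝ≥0∞ :=
  ∫⁻ p in Ioo (0 : ℝ) T ×ˢ Ioo (0 : ℝ) T,
    ENNReal.ofReal ((p.1 + p.2) ^ (-(2 * j)) * (G p.1 p.2) ^ 2)

/-- The half-closed triangle `δ < ν ≤ μ < R` in the `(μ, ν)` plane. -/
def lowerTriangle (δ R : ℝ) : Set (ℝ × ℝ) := {p | δ < p.2 ∧ p.2 ≤ p.1 ∧ p.1 < R}

lemma measurableSet_lowerTriangle (δ R : ℝ) : MeasurableSet (lowerTriangle δ R) :=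
  (measurableSet_lt measurable_const measurable_snd).inter
    ((measurableSet_le measurable_snd measurable_fst).inter
      (measurableSet_lt measurable_fst measurable_const))

lemma lowerTriangle_subset_Icc_prod (δ R : ℝ) :
    lowerTriangle δ R ⊆ Icc δ R ×ˢ Icc δ R := by
  rintro ⟨a, b⟩ ⟨h1, h2, h3⟩
  simp only at h1 h2 h3
  exact ⟨⟨by simp only; linarith, h3.le⟩, ⟨h1.le, by simp only; linarith⟩⟩

lemma integrableOn_lowerTriangle {δ R : ℝ} {f : ℝ × ℝ → ℝ}
    (hf : ContinuousOn f (Icc δ R ×ˢ Icc δ R)) : IntegrableOn f (lowerTriangle δ R) :=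
  (hf.integrableOn_compact (isCompact_Icc.prod isCompact_Icc)).mono_set
    (lowerTriangle_subset_Icc_prod δ R)

lemma setIntegral_lowerTriangle {δ R : ℝ} {f : ℝ × ℝ → ℝ}
    (hf : IntegrableOn f (lowerTriangle δ R)) :
    ∫ p in lowerTriangle δ R, f p = ∫ a in Ioo δ R, ∫ b in δ..a, f (a, b) := by
  rw [← integral_indicator (measurableSet_lowerTriangle δ R), Measure.volume_eq_prod,
    integral_prod _ ((integrable_indicator_iff (measurableSet_lowerTriangle δ R)).2 hf),
    ← integral_indicator measurableSet_Ioo]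
  congr 1
  ext a
  by_cases ha : a ∈ Ioo δ R
  · rw [indicator_of_mem ha, intervalIntegral.integral_of_le ha.1.le,
      ← integral_indicator measurableSet_Ioc]
    congr 1
    ext b
    have : (a, b) ∈ lowerTriangle δ R ↔ b ∈ Ioc δ a :=
      ⟨fun h => ⟨h.1, h.2.1⟩, fun h => ⟨h.1, h.2, ha.2⟩⟩
    simp only [indicator, this]
  · rw [indicator_of_notMem ha]
    have : ∀ b, (a, b) ∉ lowerTriangle δ R := fun b h => ha ⟨h.1.trans_le h.2.1, h.2.2⟩
    simp [this]

lemma setIntegral_lowerTriangle_symm {δ R : ℝ} {f : ℝ × ℝ → ℝ}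
    (hf : IntegrableOn f (lowerTriangle δ R)) :
    ∫ p in lowerTriangle δ R, f p = ∫ b in Ioo δ R, ∫ a in b..R, f (a, b) := by
  rw [← integral_indicator (measurableSet_lowerTriangle δ R), Measure.volume_eq_prod,
    integral_prod_symm _ ((integrable_indicator_iff (measurableSet_lowerTriangle δ R)).2 hf),
    ← integral_indicator measurableSet_Ioo]
  congr 1
  ext b
  by_cases hb : b ∈ Ioo δ R
  · rw [indicator_of_mem hb, intervalIntegral.integral_of_le hb.2.le,
      ← integral_Ico_eq_integral_Ioc, ← integral_indicator measurableSet_Ico]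
    congr 1
    ext a
    have : (a, b) ∈ lowerTriangle δ R ↔ a ∈ Ico b R :=
      ⟨fun h => ⟨h.2.1, h.2.2⟩, fun h => ⟨hb.1, h.1, h.2⟩⟩
    simp only [indicator, this]
  · rw [indicator_of_notMem hb]
    have : ∀ a, (a, b) ∉ lowerTriangle δ R := fun a h => hb ⟨h.1, h.2.1.trans_lt h.2.2⟩
    simp [this]

/-- Divergence theorem on the triangle `δ < ν ≤ μ < R`, discarding the nonnegative outgoing fluxes
through `μ = R` and `ν = δ`. -/
lemma setIntegral_lowerTriangle_le_of_flux {δ R : ℝ}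
    {F₁ F₂ D₁ D₂ g h : ℝ × ℝ → ℝ}
    (hF₁c : ContinuousOn F₁ (Icc δ R ×ˢ Icc δ R)) (hF₂c : ContinuousOn F₂ (Icc δ R ×ˢ Icc δ R))
    (hD₁c : ContinuousOn D₁ (Icc δ R ×ˢ Icc δ R)) (hD₂c : ContinuousOn D₂ (Icc δ R ×ˢ Icc δ R))
    (hgc : ContinuousOn g (Icc δ R ×ˢ Icc δ R)) (hhc : ContinuousOn h (Icc δ R ×ˢ Icc δ R))
    (hD₁ : ∀ a ∈ Icc δ R, ∀ b ∈ Icc δ R, HasDerivAt (fun x => F₁ (x, b)) (D₁ (a, b)) a)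
    (hD₂ : ∀ a ∈ Icc δ R, ∀ b ∈ Icc δ R, HasDerivAt (fun y => F₂ (a, y)) (D₂ (a, b)) b)
    (hF₁ : ∀ p ∈ Icc δ R ×ˢ Icc δ R, 0 ≤ F₁ p) (hF₂ : ∀ p ∈ Icc δ R ×ˢ Icc δ R, 0 ≤ F₂ p)
    (hle : ∀ p ∈ lowerTriangle δ R, h p + D₁ p - D₂ p ≤ g p) :
    ∫ p in lowerTriangle δ R, h p
      ≤ (∫ p in lowerTriangle δ R, g p) + ∫ t in Ioo δ R, (F₁ (t, t) + F₂ (t, t)) := by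
  have iD₁ := integrableOn_lowerTriangle hD₁c
  have iD₂ := integrableOn_lowerTriangle hD₂c
  have ig := integrableOn_lowerTriangle hgc
  have ih := integrableOn_lowerTriangle hhc
  have hdiag {F : ℝ × ℝ → ℝ} (hF : ContinuousOn F (Icc δ R ×ˢ Icc δ R)) :
      IntegrableOn (fun t => F (t, t)) (Ioo δ R) :=
    ((hF.comp (f := fun t : ℝ => (t, t)) (by fun_prop)
      fun t ht => ⟨ht, ht⟩).integrableOn_compact isCompact_Icc).mono_set Ioo_subset_Icc_self
  have key := setIntegral_mono_on ((ih.add iD₁).sub iD₂) ig (measurableSet_lowerTriangle δ R) hle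
  have split : ∫ p in lowerTriangle δ R, (h + D₁ - D₂) p
      = (∫ p in lowerTriangle δ R, h p) + (∫ p in lowerTriangle δ R, D₁ p)
        - ∫ p in lowerTriangle δ R, D₂ p := by
    rw [integral_sub' (ih.add iD₁) iD₂, integral_add' ih iD₁]
  rw [split] at key
  have e₁ : -∫ t in Ioo δ R, F₁ (t, t) ≤ ∫ p in lowerTriangle δ R, D₁ p := by
    rw [setIntegral_lowerTriangle_symm iD₁, ← integral_neg]
    have hin : ∀ b ∈ Ioo δ R, ∫ a in b..R, D₁ (a, b) = F₁ (R, b) - F₁ (b, b) := by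
      intro b hb
      have hsub : uIcc b R ⊆ Icc δ R := by
        rw [uIcc_of_le hb.2.le]; exact Icc_subset_Icc_left hb.1.le
      refine intervalIntegral.integral_eq_sub_of_hasDerivAt (f := fun x => F₁ (x, b))
        (fun a ha => hD₁ a (hsub ha) b ⟨hb.1.le, hb.2.le⟩) ?_
      exact (hD₁c.comp (f := fun x : ℝ => (x, b)) (by fun_prop)
        fun a ha => ⟨hsub ha, hb.1.le, hb.2.le⟩).intervalIntegrable
    rw [setIntegral_congr_fun measurableSet_Ioo hin]
    have hR : IntegrableOn (fun b => F₁ (R, b)) (Ioo δ R) := by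
      rcases lt_or_ge δ R with hlt | hge
      · exact ((hF₁c.comp (f := fun t : ℝ => (R, t)) (by fun_prop)
          fun t ht => ⟨⟨hlt.le, le_rfl⟩, ht⟩).integrableOn_compact isCompact_Icc).mono_set
            Ioo_subset_Icc_self
      · simp [Ioo_eq_empty_of_le hge]
    refine setIntegral_mono_on (hdiag hF₁c).neg (hR.sub (hdiag hF₁c)) measurableSet_Ioo ?_
    intro b hb
    have := hF₁ (R, b) ⟨⟨(hb.1.trans hb.2).le, le_rfl⟩, hb.1.le, hb.2.le⟩
    linarith
  have e₂ : ∫ p in lowerTriangle δ R, D₂ p ≤ ∫ t in Ioo δ R, F₂ (t, t) := by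
    rw [setIntegral_lowerTriangle iD₂]
    have hin : ∀ a ∈ Ioo δ R, ∫ b in δ..a, D₂ (a, b) = F₂ (a, a) - F₂ (a, δ) := by
      intro a ha
      have hsub : uIcc δ a ⊆ Icc δ R := by
        rw [uIcc_of_le ha.1.le]; exact Icc_subset_Icc_right ha.2.le
      refine intervalIntegral.integral_eq_sub_of_hasDerivAt (f := fun y => F₂ (a, y))
        (fun b hb => hD₂ a ⟨ha.1.le, ha.2.le⟩ b (hsub hb)) ?_
      exact (hD₂c.comp (f := fun y : ℝ => (a, y)) (by fun_prop)
        fun b hb => ⟨⟨ha.1.le, ha.2.le⟩, hsub hb⟩).intervalIntegrable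
    rw [setIntegral_congr_fun measurableSet_Ioo hin]
    have hδ : IntegrableOn (fun a => F₂ (a, δ)) (Ioo δ R) := by
      rcases lt_or_ge δ R with hlt | hge
      · exact ((hF₂c.comp (f := fun t : ℝ => (t, δ)) (by fun_prop)
          fun t ht => ⟨ht, ⟨le_rfl, hlt.le⟩⟩).integrableOn_compact isCompact_Icc).mono_set
            Ioo_subset_Icc_self
      · simp [Ioo_eq_empty_of_le hge]
    refine setIntegral_mono_on ((hdiag hF₂c).sub hδ) (hdiag hF₂c) measurableSet_Ioo ?_
    intro a ha
    have := hF₂ (a, δ) ⟨⟨ha.1.le, ha.2.le⟩, le_rfl, (ha.1.trans ha.2).le⟩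
    linarith
  rw [integral_add (hdiag hF₁c) (hdiag hF₂c)]
  linarith

/-- Pointwise form of the energy inequality: `w = (a + b) / a³` is the weight, `u, um, un, x` are
the values of `W, ∂_μ W, ∂_ν W, ∂_μ ∂_ν W`, and `k, k'` those of the potential and its derivative. -/
lemma energy_divergence_le {a b u um un x k k' c M : ℝ} (hb : 0 < b) (hba : b ≤ a)
    (hk : c ≤ k) (hk' : |k'| ≤ M) (haM : a * M ≤ c) :
    c * (u ^ 2 / (a + b) ^ 5)
      + ((1 / a ^ 3 - 3 * (a + b) / a ^ 4) * (un ^ 2 + k * u ^ 2 / (a + b) ^ 2)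
        + (a + b) / a ^ 3 * (2 * un * x + (k' * (2 * b ^ 2 / (a + b) ^ 2) * u ^ 2
            + k * (2 * u * um)) / (a + b) ^ 2 - 2 * k * u ^ 2 / (a + b) ^ 3))
      - (1 / a ^ 3 * (um ^ 2 + k * u ^ 2 / (a + b) ^ 2)
        + (a + b) / a ^ 3 * (2 * um * x + (k' * (2 * a ^ 2 / (a + b) ^ 2) * u ^ 2
            + k * (2 * u * un)) / (a + b) ^ 2 - 2 * k * u ^ 2 / (a + b) ^ 3))
      ≤ 16 * (((a + b) ^ 2 * x - k * u) ^ 2 / (a + b) ^ 5) := by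
  have ha : 0 < a := hb.trans_le hba
  have hc : 0 ≤ c := le_trans (mul_nonneg ha.le ((abs_nonneg _).trans hk')) haM
  obtain ⟨s, hs⟩ : ∃ s, s = a + b := ⟨_, rfl⟩
  obtain ⟨g, hg⟩ : ∃ g, g = s ^ 2 * x - k * u := ⟨_, rfl⟩
  have hs0 : 0 < s := by linarith
  rw [← hs, ← hg]
  have hx : x = (g + k * u) / s ^ 2 := by rw [hg]; field_simp; ring
  have hbs : b = s - a := by linarith
  have ident : (1 / a ^ 3 - 3 * s / a ^ 4) * (un ^ 2 + k * u ^ 2 / s ^ 2)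
        + s / a ^ 3 * (2 * un * x + (k' * (2 * b ^ 2 / s ^ 2) * u ^ 2
            + k * (2 * u * um)) / s ^ 2 - 2 * k * u ^ 2 / s ^ 3)
      - (1 / a ^ 3 * (um ^ 2 + k * u ^ 2 / s ^ 2)
        + s / a ^ 3 * (2 * um * x + (k' * (2 * a ^ 2 / s ^ 2) * u ^ 2
            + k * (2 * u * un)) / s ^ 2 - 2 * k * u ^ 2 / s ^ 3))
      = - ((3 * s / a - 1) * un ^ 2 + um ^ 2 + 2 * (um - un) * g / s) / a ^ 3
        - (3 * k - 2 * ((b - a) / s) * (a * k')) * u ^ 2 / (a ^ 4 * s) := by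
    rw [hx, hbs]
    field_simp
    ring
  have h1 : 3 ≤ 3 * s / a := by rw [le_div_iff₀ ha]; linarith
  have h2 : - (2 * g ^ 2 / s ^ 2)
      ≤ (3 * s / a - 1) * un ^ 2 + um ^ 2 + 2 * (um - un) * g / s := by
    have : 2 * (um - un) * g / s = 2 * (um - un) * (g / s) := by ring
    have e : 2 * g ^ 2 / s ^ 2 = 2 * (g / s) ^ 2 := by ring
    rw [this, e]
    nlinarith [sq_nonneg (um - un + 2 * (g / s)), sq_nonneg (um + un),
      mul_nonneg (sub_nonneg.2 h1) (sq_nonneg un)]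
  have h3 : c ≤ 3 * k - 2 * ((b - a) / s) * (a * k') := by
    have hr : |(b - a) / s| ≤ 1 := by
      rw [abs_div, abs_of_pos hs0, div_le_one hs0, abs_le]; constructor <;> linarith
    have hak : |a * k'| ≤ c := by
      rw [abs_mul, abs_of_pos ha]; exact (mul_le_mul_of_nonneg_left hk' ha.le).trans haM
    have : |((b - a) / s) * (a * k')| ≤ c := by
      rw [abs_mul]
      calc _ ≤ 1 * c := mul_le_mul hr hak (abs_nonneg _) zero_le_one
        _ = c := one_mul c
    have := (abs_le.1 this).2
    nlinarith
  have h4 : c * (u ^ 2 / s ^ 5)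
      ≤ (3 * k - 2 * ((b - a) / s) * (a * k')) * u ^ 2 / (a ^ 4 * s) := by
    have : a ^ 4 * s ≤ s ^ 5 := by
      have : a ^ 4 ≤ s ^ 4 := pow_le_pow_left₀ ha.le (by linarith) 4
      nlinarith
    rw [mul_div_assoc]
    exact mul_le_mul h3 (div_le_div_of_nonneg_left (sq_nonneg u) (by positivity) this)
      (by positivity) (hc.trans h3)
  have h5 : - ((3 * s / a - 1) * un ^ 2 + um ^ 2 + 2 * (um - un) * g / s) / a ^ 3
      ≤ 16 * (g ^ 2 / s ^ 5) := by
    have hpow : s ^ 3 ≤ 8 * a ^ 3 := by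
      have : s ^ 3 ≤ (2 * a) ^ 3 := pow_le_pow_left₀ hs0.le (by linarith) 3
      linarith [this, mul_pow 2 a 3]
    calc _ ≤ (2 * g ^ 2 / s ^ 2) / a ^ 3 :=
          div_le_div_of_nonneg_right (by linarith) (by positivity)
      _ ≤ _ := by
          rw [div_div, ← mul_div_assoc, div_le_div_iff₀ (by positivity) (by positivity)]
          have : 0 ≤ g ^ 2 * s ^ 2 := by positivity
          nlinarith [mul_le_mul_of_nonneg_left hpow this]
  linarith

/-- On the open square `(0, T)²`, `W` has continuous first partials `Wm = ∂_μ W`, `Wn = ∂_ν W` and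
a continuous mixed second partial `X = ∂_μ ∂_ν W`. -/
structure HasMixedPartials (T : ℝ) (W Wm Wn X : ℝ × ℝ → ℝ) : Prop where
  fst : ∀ a ∈ Ioo 0 T, ∀ b ∈ Ioo 0 T, HasDerivAt (fun x => W (x, b)) (Wm (a, b)) a
  snd : ∀ a ∈ Ioo 0 T, ∀ b ∈ Ioo 0 T, HasDerivAt (fun y => W (a, y)) (Wn (a, b)) b
  snd_fst : ∀ a ∈ Ioo 0 T, ∀ b ∈ Ioo 0 T, HasDerivAt (fun y => Wm (a, y)) (X (a, b)) b
  fst_snd : ∀ a ∈ Ioo 0 T, ∀ b ∈ Ioo 0 T, HasDerivAt (fun x => Wn (x, b)) (X (a, b)) a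
  cont : ContinuousOn W (Ioo 0 T ×ˢ Ioo 0 T)
  cont_fst : ContinuousOn Wm (Ioo 0 T ×ˢ Ioo 0 T)
  cont_snd : ContinuousOn Wn (Ioo 0 T ×ˢ Ioo 0 T)
  cont_mixed : ContinuousOn X (Ioo 0 T ×ˢ Ioo 0 T)

lemma HasMixedPartials.swap {T : ℝ} {W Wm Wn X : ℝ × ℝ → ℝ}
    (h : HasMixedPartials T W Wm Wn X) :
    HasMixedPartials T (W ∘ Prod.swap) (Wn ∘ Prod.swap) (Wm ∘ Prod.swap) (X ∘ Prod.swap) where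
  fst a ha b hb := h.snd b hb a ha
  snd a ha b hb := h.fst b hb a ha
  snd_fst a ha b hb := h.fst_snd b hb a ha
  fst_snd a ha b hb := h.snd_fst b hb a ha
  cont := h.cont.comp continuous_swap.continuousOn fun _ hp => ⟨hp.2, hp.1⟩
  cont_fst := h.cont_snd.comp continuous_swap.continuousOn fun _ hp => ⟨hp.2, hp.1⟩
  cont_snd := h.cont_fst.comp continuous_swap.continuousOn fun _ hp => ⟨hp.2, hp.1⟩
  cont_mixed := h.cont_mixed.comp continuous_swap.continuousOn fun _ hp => ⟨hp.2, hp.1⟩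

lemma harmonicMean_mem_Ioo {T a b : ℝ} (ha : a ∈ Ioo 0 T) (hb : b ∈ Ioo 0 T) :
    2 * a * b / (a + b) ∈ Ioo 0 T := by
  obtain ⟨ha0, haT⟩ := ha
  obtain ⟨hb0, hbT⟩ := hb
  refine ⟨by positivity, ?_⟩
  rw [div_lt_iff₀ (by positivity)]
  nlinarith [mul_pos ha0 (sub_pos.2 hbT), mul_pos hb0 (sub_pos.2 haT)]

/-- The integrand of the initial energy on the diagonal. -/
noncomputable def diagonalEnergy (κ : ℝ → ℝ) (W Wm Wn : ℝ × ℝ → ℝ) (t : ℝ) : ℝ :=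
  2 / t ^ 2 * (Wm (t, t) ^ 2 + Wn (t, t) ^ 2 + κ t * W (t, t) ^ 2 / (2 * t ^ 2))

/-- The source term `(μ + ν)² X - κ(2μν/(μ+ν)) W` of the mode equation. -/
noncomputable def modeSource (κ : ℝ → ℝ) (W X : ℝ × ℝ → ℝ) (p : ℝ × ℝ) : ℝ :=
  (p.1 + p.2) ^ 2 * X p - κ (2 * p.1 * p.2 / (p.1 + p.2)) * W p

lemma setIntegral_lowerTriangle_energy_le {T c M : ℝ} {κ κ' : ℝ → ℝ} {W Wm Wn X : ℝ × ℝ → ℝ}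
    (hW : HasMixedPartials T W Wm Wn X) (hκ : ∀ x ∈ Ioo 0 T, HasDerivAt κ (κ' x) x)
    (hκ'c : ContinuousOn κ' (Ioo 0 T)) (hc : 0 ≤ c) (hκc : ∀ x ∈ Ioo 0 T, c ≤ κ x)
    (hM : ∀ x ∈ Ioo 0 T, |κ' x| ≤ M) (hTM : T * M ≤ c) {δ R : ℝ} (hδ : 0 < δ) (hR : R < T) :
    ∫⁻ p in lowerTriangle δ R, ENNReal.ofReal (c * (W p ^ 2 / (p.1 + p.2) ^ 5))
      ≤ (∫⁻ p in Ioo 0 T ×ˢ Ioo 0 T,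
          ENNReal.ofReal (16 * (modeSource κ W X p ^ 2 / (p.1 + p.2) ^ 5)))
        + ∫⁻ t in Ioo 0 T, ENNReal.ofReal (diagonalEnergy κ W Wm Wn t) := by
  have hsub : Icc δ R ⊆ Ioo 0 T := Icc_subset_Ioo hδ hR
  have hsub2 : Icc δ R ×ˢ Icc δ R ⊆ Ioo 0 T ×ˢ Ioo 0 T := prod_mono hsub hsub
  have cW := hW.cont.mono hsub2
  have cWm := hW.cont_fst.mono hsub2
  have cWn := hW.cont_snd.mono hsub2
  have cX := hW.cont_mixed.mono hsub2
  have pos1 : ∀ p ∈ Icc δ R ×ˢ Icc δ R, 0 < p.1 := fun p hp => hδ.trans_le hp.1.1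
  have pos2 : ∀ p ∈ Icc δ R ×ˢ Icc δ R, 0 < p.2 := fun p hp => hδ.trans_le hp.2.1
  have n1 : ∀ p ∈ Icc δ R ×ˢ Icc δ R, p.1 ≠ 0 := fun p hp => (pos1 p hp).ne'
  have ns : ∀ p ∈ Icc δ R ×ˢ Icc δ R, p.1 + p.2 ≠ 0 :=
    fun p hp => (add_pos (pos1 p hp) (pos2 p hp)).ne'
  have nsp : ∀ n : ℕ, ∀ p ∈ Icc δ R ×ˢ Icc δ R, (p.1 + p.2) ^ n ≠ 0 :=
    fun n p hp => pow_ne_zero n (ns p hp)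
  have n1p : ∀ n : ℕ, ∀ p ∈ Icc δ R ×ˢ Icc δ R, p.1 ^ n ≠ 0 :=
    fun n p hp => pow_ne_zero n (n1 p hp)
  have cx : ContinuousOn (fun p : ℝ × ℝ => 2 * p.1 * p.2 / (p.1 + p.2))
      (Icc δ R ×ˢ Icc δ R) := by fun_prop (disch := assumption)
  have mx : MapsTo (fun p : ℝ × ℝ => 2 * p.1 * p.2 / (p.1 + p.2))
      (Icc δ R ×ˢ Icc δ R) (Ioo 0 T) := fun p hp =>
    harmonicMean_mem_Ioo (hsub hp.1) (hsub hp.2)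
  have cκ : ContinuousOn (fun p : ℝ × ℝ => κ (2 * p.1 * p.2 / (p.1 + p.2)))
      (Icc δ R ×ˢ Icc δ R) :=
    ContinuousOn.comp (fun x hx => (hκ x hx).continuousAt.continuousWithinAt) cx mx
  have cκ' : ContinuousOn (fun p : ℝ × ℝ => κ' (2 * p.1 * p.2 / (p.1 + p.2)))
      (Icc δ R ×ˢ Icc δ R) := hκ'c.comp cx mx
  have hxfst (a b : ℝ) (ha : a ∈ Icc δ R) (hb : b ∈ Icc δ R) :
      HasDerivAt (fun x => κ (2 * x * b / (x + b)))
        (κ' (2 * a * b / (a + b)) * (2 * b ^ 2 / (a + b) ^ 2)) a := by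
    have hs := ns (a, b) ⟨ha, hb⟩
    refine (hκ _ (mx (x := (a, b)) ⟨ha, hb⟩)).comp a ?_
    refine ((((hasDerivAt_id a).const_mul 2).mul_const b).div
      ((hasDerivAt_id a).add_const b) hs).congr_deriv ?_
    simp only [id]
    ring
  have hxsnd (a b : ℝ) (ha : a ∈ Icc δ R) (hb : b ∈ Icc δ R) :
      HasDerivAt (fun y => κ (2 * a * y / (a + y)))
        (κ' (2 * a * b / (a + b)) * (2 * a ^ 2 / (a + b) ^ 2)) b := by
    have hs := ns (a, b) ⟨ha, hb⟩
    refine (hκ _ (mx (x := (a, b)) ⟨ha, hb⟩)).comp b ?_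
    refine (((hasDerivAt_id b).const_mul (2 * a)).div
      ((hasDerivAt_id b).const_add a) hs).congr_deriv ?_
    simp only [id]
    ring
  obtain ⟨k, hk⟩ : ∃ k : ℝ × ℝ → ℝ, k = fun p => κ (2 * p.1 * p.2 / (p.1 + p.2)) := ⟨_, rfl⟩
  obtain ⟨k', hk'⟩ : ∃ k' : ℝ × ℝ → ℝ, k' = fun p => κ' (2 * p.1 * p.2 / (p.1 + p.2)) := ⟨_, rfl⟩
  rw [← hk] at cκ
  rw [← hk'] at cκ'
  let F₁ : ℝ × ℝ → ℝ := fun p => (p.1 + p.2) / p.1 ^ 3 *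
    (Wn p ^ 2 + k p * W p ^ 2 / (p.1 + p.2) ^ 2)
  let F₂ : ℝ × ℝ → ℝ := fun p => (p.1 + p.2) / p.1 ^ 3 *
    (Wm p ^ 2 + k p * W p ^ 2 / (p.1 + p.2) ^ 2)
  let D₁ : ℝ × ℝ → ℝ := fun p =>
    (1 / p.1 ^ 3 - 3 * (p.1 + p.2) / p.1 ^ 4)
      * (Wn p ^ 2 + k p * W p ^ 2 / (p.1 + p.2) ^ 2)
    + (p.1 + p.2) / p.1 ^ 3 * (2 * Wn p * X p
      + (k' p * (2 * p.2 ^ 2 / (p.1 + p.2) ^ 2) * W p ^ 2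
        + k p * (2 * W p * Wm p)) / (p.1 + p.2) ^ 2
      - 2 * k p * W p ^ 2 / (p.1 + p.2) ^ 3)
  let D₂ : ℝ × ℝ → ℝ := fun p =>
    1 / p.1 ^ 3
      * (Wm p ^ 2 + k p * W p ^ 2 / (p.1 + p.2) ^ 2)
    + (p.1 + p.2) / p.1 ^ 3 * (2 * Wm p * X p
      + (k' p * (2 * p.1 ^ 2 / (p.1 + p.2) ^ 2) * W p ^ 2
        + k p * (2 * W p * Wn p)) / (p.1 + p.2) ^ 2
      - 2 * k p * W p ^ 2 / (p.1 + p.2) ^ 3)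
  have κnn : ∀ p ∈ Icc δ R ×ˢ Icc δ R, 0 ≤ k p :=
    fun p hp => hk ▸ hc.trans (hκc _ (mx hp))
  have hgc : ContinuousOn (fun p => 16 * (modeSource κ W X p ^ 2 / (p.1 + p.2) ^ 5))
      (Icc δ R ×ˢ Icc δ R) := by
    have : modeSource κ W X = fun p => (p.1 + p.2) ^ 2 * X p - k p * W p := by
      ext p; simp only [modeSource, hk]
    simp only [this]
    fun_prop (disch := first | assumption | exact nsp _)
  have hhc : ContinuousOn (fun p : ℝ × ℝ => c * (W p ^ 2 / (p.1 + p.2) ^ 5))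
      (Icc δ R ×ˢ Icc δ R) := by
    fun_prop (disch := first | assumption | exact nsp _)
  have hF₁c : ContinuousOn F₁ (Icc δ R ×ˢ Icc δ R) := by
    dsimp only [F₁]
    fun_prop (disch := first | assumption | exact nsp _ | exact n1p _)
  have hF₂c : ContinuousOn F₂ (Icc δ R ×ˢ Icc δ R) := by
    dsimp only [F₂]
    fun_prop (disch := first | assumption | exact nsp _ | exact n1p _)
  have hD₁c : ContinuousOn D₁ (Icc δ R ×ˢ Icc δ R) := by
    dsimp only [D₁]
    fun_prop (disch := first | assumption | exact nsp _ | exact n1p _)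
  have hD₂c : ContinuousOn D₂ (Icc δ R ×ˢ Icc δ R) := by
    dsimp only [D₂]
    fun_prop (disch := first | assumption | exact nsp _ | exact n1p _)
  have hdiag : ∀ t ∈ Ioo δ R, F₁ (t, t) + F₂ (t, t) = diagonalEnergy κ W Wm Wn t := by
    intro t ht
    have ht0 : 0 < t := hδ.trans ht.1
    have : 2 * t * t / (t + t) = t := by field_simp; ring
    simp only [F₁, F₂, hk, diagonalEnergy, this]
    field_simp
    ring
  have key := setIntegral_lowerTriangle_le_of_flux (δ := δ) (R := R) (F₁ := F₁) (F₂ := F₂)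
    (D₁ := D₁) (D₂ := D₂) (g := fun p => 16 * (modeSource κ W X p ^ 2 / (p.1 + p.2) ^ 5))
    (h := fun p => c * (W p ^ 2 / (p.1 + p.2) ^ 5)) hF₁c hF₂c
    hD₁c hD₂c hgc hhc
    (by
      subst hk hk'
      intro a ha b hb
      have hs : a + b ≠ 0 := ns (a, b) ⟨ha, hb⟩
      have ha0 : a ≠ 0 := n1 (a, b) ⟨ha, hb⟩
      have hds := (hasDerivAt_id a).add_const b
      refine ((hds.div ((hasDerivAt_id a).pow 3) (pow_ne_zero 3 ha0)).mul
        (((hW.fst_snd a (hsub ha) b (hsub hb)).pow 2).add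
          (((hxfst a b ha hb).mul ((hW.fst a (hsub ha) b (hsub hb)).pow 2)).div
            (hds.pow 2) (pow_ne_zero 2 hs)))).congr_deriv ?_
      simp only [D₁, id, Pi.pow_apply, Pi.add_apply, Pi.mul_apply, Pi.div_apply]
      field_simp
      push_cast
      ring)
    (by
      subst hk hk'
      intro a ha b hb
      have hs : a + b ≠ 0 := ns (a, b) ⟨ha, hb⟩
      have ha0 : a ≠ 0 := n1 (a, b) ⟨ha, hb⟩
      have hds := (hasDerivAt_id b).const_add a
      refine ((hds.div_const (a ^ 3)).mul
        (((hW.snd_fst a (hsub ha) b (hsub hb)).pow 2).add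
          (((hxsnd a b ha hb).mul ((hW.snd a (hsub ha) b (hsub hb)).pow 2)).div
            (hds.pow 2) (pow_ne_zero 2 hs)))).congr_deriv ?_
      simp only [D₂, id, Pi.pow_apply, Pi.add_apply, Pi.mul_apply, Pi.div_apply]
      field_simp
      push_cast
      ring)
    (fun p hp => by
      have := pos1 p hp; have := pos2 p hp; have := κnn p hp
      simp only [F₁]; positivity)
    (fun p hp => by
      have := pos1 p hp; have := pos2 p hp; have := κnn p hp
      simp only [F₂]; positivity)
    (by
      subst hk hk'
      rintro ⟨a, b⟩ hp
      have hp' := lowerTriangle_subset_Icc_prod δ R hp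
      have hx := mx hp'
      have hM0 : 0 ≤ M := (abs_nonneg _).trans (hM _ hx)
      exact energy_divergence_le (pos2 _ hp') hp.2.1 (hκc _ hx) (hM _ hx)
        ((mul_le_mul_of_nonneg_right (hsub hp'.1).2.le hM0).trans hTM))
  rw [setIntegral_congr_fun measurableSet_Ioo hdiag] at key
  have hdc : IntegrableOn (diagonalEnergy κ W Wm Wn) (Ioo δ R) := by
    refine IntegrableOn.congr_fun ?_ hdiag measurableSet_Ioo
    exact (((hF₁c.add hF₂c).comp (f := fun t : ℝ => (t, t)) (by fun_prop)
      fun t ht => ⟨ht, ht⟩).integrableOn_compact isCompact_Icc).mono_set Ioo_subset_Icc_self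
  have spos : ∀ p ∈ lowerTriangle δ R, 0 < p.1 + p.2 := fun p hp =>
    have hp' := lowerTriangle_subset_Icc_prod δ R hp
    add_pos (pos1 p hp') (pos2 p hp')
  rw [← ofReal_integral_eq_lintegral_ofReal (integrableOn_lowerTriangle hhc)
    ((ae_restrict_mem (measurableSet_lowerTriangle δ R)).mono fun p hp => by
      have := spos p hp; simp only [Pi.zero_apply]; positivity)]
  refine (ENNReal.ofReal_le_ofReal key).trans (ENNReal.ofReal_add_le.trans (add_le_add ?_ ?_))
  · rw [ofReal_integral_eq_lintegral_ofReal (integrableOn_lowerTriangle hgc)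
      ((ae_restrict_mem (measurableSet_lowerTriangle δ R)).mono fun p hp => by
        have := spos p hp; simp only [Pi.zero_apply]; positivity)]
    exact lintegral_mono_set ((lowerTriangle_subset_Icc_prod δ R).trans hsub2)
  · rw [ofReal_integral_eq_lintegral_ofReal hdc
      ((ae_restrict_mem measurableSet_Ioo).mono fun t ht => by
        have ht' := hsub (Ioo_subset_Icc_self ht)
        have := hc.trans (hκc t ht')
        simp only [Pi.zero_apply, diagonalEnergy]; positivity)]
    exact lintegral_mono_set (Ioo_subset_Icc_self.trans hsub)

lemma setLIntegral_lowerTriangle_le_of_forall {T : ℝ} {f : ℝ × ℝ → ℝ≥0∞} {A : ℝ≥0∞}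
    (h : ∀ δ R, 0 < δ → R < T → ∫⁻ p in lowerTriangle δ R, f p ≤ A) :
    ∫⁻ p in lowerTriangle 0 T, f p ≤ A := by
  have hmono : Monotone fun n : ℕ =>
      lowerTriangle (1 / ((n : ℝ) + 1)) (T - 1 / ((n : ℝ) + 1)) := by
    intro m n hmn p hp
    have : 1 / ((n : ℝ) + 1) ≤ 1 / ((m : ℝ) + 1) := Nat.one_div_le_one_div hmn
    exact ⟨this.trans_lt hp.1, hp.2.1, hp.2.2.trans_le (by linarith)⟩
  have hU : lowerTriangle 0 T
      = ⋃ n : ℕ, lowerTriangle (1 / ((n : ℝ) + 1)) (T - 1 / ((n : ℝ) + 1)) := by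
    ext p
    simp only [mem_iUnion]
    constructor
    · rintro ⟨h1, h2, h3⟩
      obtain ⟨n, hn⟩ := exists_nat_one_div_lt (lt_min h1 (sub_pos.2 h3))
      exact ⟨n, hn.trans_le (min_le_left _ _), h2, by
        linarith [hn.trans_le (min_le_right _ _)]⟩
    · rintro ⟨n, h1, h2, h3⟩
      have : 0 < 1 / ((n : ℝ) + 1) := Nat.one_div_pos_of_nat
      exact ⟨this.trans h1, h2, by linarith⟩
  rw [hU, setLIntegral_iUnion_of_directed _ hmono.directed_le]
  refine iSup_le fun n => h _ _ Nat.one_div_pos_of_nat ?_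
  have : 0 < 1 / ((n : ℝ) + 1) := Nat.one_div_pos_of_nat
  linarith

/-- Weighted energy estimate on the square. -/
lemma setLIntegral_square_energy_le {T c M : ℝ} {κ κ' : ℝ → ℝ} {W Wm Wn X : ℝ × ℝ → ℝ}
    (hW : HasMixedPartials T W Wm Wn X) (hκ : ∀ x ∈ Ioo 0 T, HasDerivAt κ (κ' x) x)
    (hκ'c : ContinuousOn κ' (Ioo 0 T)) (hc : 0 ≤ c) (hκc : ∀ x ∈ Ioo 0 T, c ≤ κ x)
    (hM : ∀ x ∈ Ioo 0 T, |κ' x| ≤ M) (hTM : T * M ≤ c) :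
    ∫⁻ p in Ioo 0 T ×ˢ Ioo 0 T, ENNReal.ofReal (c * (W p ^ 2 / (p.1 + p.2) ^ 5))
      ≤ 2 * ((∫⁻ p in Ioo 0 T ×ˢ Ioo 0 T,
          ENNReal.ofReal (16 * (modeSource κ W X p ^ 2 / (p.1 + p.2) ^ 5)))
        + ∫⁻ t in Ioo 0 T, ENNReal.ofReal (diagonalEnergy κ W Wm Wn t)) := by
  have hcov : Ioo (0 : ℝ) T ×ˢ Ioo (0 : ℝ) T
      ⊆ lowerTriangle 0 T ∪ Prod.swap ⁻¹' lowerTriangle 0 T := by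
    rintro ⟨a, b⟩ ⟨ha, hb⟩
    rcases le_total b a with h | h
    · exact Or.inl ⟨hb.1, h, ha.2⟩
    · exact Or.inr ⟨ha.1, h, hb.2⟩
  have hmp : MeasurePreserving (Prod.swap : ℝ × ℝ → ℝ × ℝ) volume volume :=
    Measure.measurePreserving_swap
  have hme : MeasurableEmbedding (Prod.swap : ℝ × ℝ → ℝ × ℝ) :=
    MeasurableEquiv.prodComm.measurableEmbedding
  refine (lintegral_mono_set hcov).trans ((lintegral_union_le _ _ _).trans ?_)
  rw [two_mul]
  refine add_le_add (setLIntegral_lowerTriangle_le_of_forall fun δ R hδ hR =>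
    setIntegral_lowerTriangle_energy_le hW hκ hκ'c hc hκc hM hTM hδ hR) ?_
  have hsq : Prod.swap ⁻¹' (Ioo (0 : ℝ) T ×ˢ Ioo (0 : ℝ) T) = Ioo (0 : ℝ) T ×ˢ Ioo (0 : ℝ) T :=
    preimage_swap_prod _ _
  have e1 := hmp.setLIntegral_comp_preimage_emb hme
    (fun p => ENNReal.ofReal (c * ((W ∘ Prod.swap) p ^ 2 / (p.1 + p.2) ^ 5))) (lowerTriangle 0 T)
  have e2 := hmp.setLIntegral_comp_preimage_emb hme
    (fun p => ENNReal.ofReal (16 * (modeSource κ W X p ^ 2 / (p.1 + p.2) ^ 5)))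
    (Ioo (0 : ℝ) T ×ˢ Ioo (0 : ℝ) T)
  have e3 : diagonalEnergy κ (W ∘ Prod.swap) (Wn ∘ Prod.swap) (Wm ∘ Prod.swap)
      = diagonalEnergy κ W Wm Wn := by
    ext t
    simp only [diagonalEnergy, Function.comp, Prod.swap]
    ring
  have e4 : ∀ p : ℝ × ℝ, modeSource κ (W ∘ Prod.swap) (X ∘ Prod.swap) p
      = modeSource κ W X p.swap := by
    intro p
    simp only [modeSource, Function.comp, Prod.fst_swap, Prod.snd_swap, add_comm p.2 p.1,
      mul_right_comm 2 p.2 p.1]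
  simp only [Function.comp, Prod.swap_swap, Prod.fst_swap, Prod.snd_swap] at e1
  rw [hsq] at e2
  simp only [add_comm (Prod.snd _) (Prod.fst _)] at e1
  rw [e1, ← e2]
  refine setLIntegral_lowerTriangle_le_of_forall fun δ R hδ hR => ?_
  refine (setIntegral_lowerTriangle_energy_le hW.swap hκ hκ'c hc hκc hM hTM hδ hR).trans ?_
  rw [e3]
  simp only [e4, Prod.fst_swap, Prod.snd_swap, add_comm (Prod.snd _) (Prod.fst _)]
  exact le_rfl

lemma ContDiffOn.exists_hasMixedPartials {T : ℝ} {W : ℝ × ℝ → ℝ}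
    (hW : ContDiffOn ℝ 2 W (Ioo 0 T ×ˢ Ioo 0 T)) :
    ∃ Wm Wn X, HasMixedPartials T W Wm Wn X ∧
      ∀ t ∈ Ioo 0 T, HasDerivAt (fun t => W (t, t)) (Wm (t, t) + Wn (t, t)) t := by
  have hopen : IsOpen (Ioo (0 : ℝ) T ×ˢ Ioo (0 : ℝ) T) := isOpen_Ioo.prod isOpen_Ioo
  have hd : ContDiffOn ℝ 1 (fderiv ℝ W) (Ioo 0 T ×ˢ Ioo 0 T) :=
    hW.fderiv_of_isOpen hopen (by norm_num)
  have hdd : ContDiffOn ℝ 0 (fderiv ℝ (fderiv ℝ W)) (Ioo 0 T ×ˢ Ioo 0 T) :=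
    hd.fderiv_of_isOpen hopen (by norm_num)
  have line1 (a b : ℝ) : HasDerivAt (fun x : ℝ => (x, b)) ((1, 0) : ℝ × ℝ) a :=
    (hasDerivAt_id a).prodMk (hasDerivAt_const a b)
  have line2 (a b : ℝ) : HasDerivAt (fun y : ℝ => (a, y)) ((0, 1) : ℝ × ℝ) b :=
    (hasDerivAt_const b a).prodMk (hasDerivAt_id b)
  have dW {a b : ℝ} (ha : a ∈ Ioo 0 T) (hb : b ∈ Ioo 0 T) :
      HasFDerivAt W (fderiv ℝ W (a, b)) (a, b) :=
    ((hW.contDiffAt (hopen.mem_nhds ⟨ha, hb⟩)).differentiableAt (by norm_num)).hasFDerivAt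
  have ddW {a b : ℝ} (v : ℝ × ℝ) (ha : a ∈ Ioo 0 T) (hb : b ∈ Ioo 0 T) :
      HasFDerivAt (fun p => fderiv ℝ W p v)
        ((ContinuousLinearMap.apply ℝ ℝ v).comp (fderiv ℝ (fderiv ℝ W) (a, b))) (a, b) :=
    (ContinuousLinearMap.apply ℝ ℝ v).hasFDerivAt.comp (a, b)
      ((hd.contDiffAt (hopen.mem_nhds ⟨ha, hb⟩)).differentiableAt (by norm_num)).hasFDerivAt
  refine ⟨fun p => fderiv ℝ W p (1, 0), fun p => fderiv ℝ W p (0, 1),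
    fun p => fderiv ℝ (fderiv ℝ W) p (1, 0) (0, 1),
    ⟨?_, ?_, ?_, ?_, hW.continuousOn, ?_, ?_, ?_⟩, ?_⟩
  · exact fun a ha b hb => (dW ha hb).comp_hasDerivAt a (line1 a b)
  · exact fun a ha b hb => (dW ha hb).comp_hasDerivAt b (line2 a b)
  · intro a ha b hb
    have hsymm : IsSymmSndFDerivAt ℝ W (a, b) :=
      (hW.contDiffAt (hopen.mem_nhds ⟨ha, hb⟩)).isSymmSndFDerivAt (by simp)
    refine ((ddW (1, 0) ha hb).comp_hasDerivAt b (line2 a b)).congr_deriv ?_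
    exact hsymm (0, 1) (1, 0)
  · intro a ha b hb
    exact (ddW (0, 1) ha hb).comp_hasDerivAt a (line1 a b)
  · exact hd.continuousOn.clm_apply continuousOn_const
  · exact hd.continuousOn.clm_apply continuousOn_const
  · exact (hdd.continuousOn.clm_apply continuousOn_const).clm_apply continuousOn_const
  · intro t ht
    refine ((dW ht ht).comp_hasDerivAt (f := fun t => (t, t)) t
      ((hasDerivAt_id t).prodMk (hasDerivAt_id t))).congr_deriv ?_
    rw [← map_add]
    simp

lemma diagonalEnergy_le {T K t r r' ρ : ℝ} {κ : ℝ → ℝ} {W Wm Wn : ℝ × ℝ → ℝ} (ht : t ∈ Ioo 0 T)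
    (hκ : κ t ≤ K) (hW : W (t, t) = t ^ 2 * r) (hWm : Wm (t, t) = t ^ 2 * ρ)
    (hWn : Wn (t, t) = t ^ 2 * r' + 2 * t * r - t ^ 2 * ρ) :
    diagonalEnergy κ W Wm Wn t ≤ (24 + K) * r ^ 2 + 6 * T ^ 2 * r' ^ 2 + 8 * T ^ 2 * ρ ^ 2 := by
  have ht0 : 0 < t := ht.1
  have e : diagonalEnergy κ W Wm Wn t
      = 2 * ((t * ρ) ^ 2 + (t * r' + 2 * r - t * ρ) ^ 2) + κ t * r ^ 2 := by
    rw [diagonalEnergy, hW, hWm, hWn]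
    field_simp
  have hsq : t ^ 2 ≤ T ^ 2 := pow_le_pow_left₀ ht0.le ht.2.le 2
  rw [e]
  nlinarith [mul_le_mul_of_nonneg_right hκ (sq_nonneg r),
    mul_le_mul_of_nonneg_right hsq (sq_nonneg ρ), mul_le_mul_of_nonneg_right hsq (sq_nonneg r'),
    sq_nonneg (t * r' - 2 * r), sq_nonneg (t * r' + t * ρ), sq_nonneg (2 * r + t * ρ)]

lemma lintegral_add_deriv_sq_le_sobNormSq {T j : ℝ} {q : ℝ → ℝ}
    (hq : ContinuousOn (fun t => t ^ (-j) * q t) (Ioo 0 T)) :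
    ∫⁻ t in Ioo 0 T, (ENNReal.ofReal ((t ^ (-j) * q t) ^ 2)
        + ENNReal.ofReal ((deriv (fun t => t ^ (-j) * q t) t) ^ 2)) ≤ sobNormSq T 2 j q := by
  rw [lintegral_add_left' (by exact ((hq.pow 2).aemeasurable measurableSet_Ioo).ennreal_ofReal)]
  simp only [sobNormSq, Finset.sum_range_succ, Finset.sum_range_zero, zero_add, iteratedDeriv_zero,
    iteratedDeriv_one]
  exact le_self_add

lemma lintegral_sq_le_sobNormSq {T j : ℝ} (s : ℕ) (q : ℝ → ℝ) :
    ∫⁻ t in Ioo 0 T, ENNReal.ofReal ((t ^ (-j) * q t) ^ 2) ≤ sobNormSq T s j q := by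
  have := Finset.single_le_sum (s := Finset.range (s + 1)) (a := 0)
    (f := fun i => ∫⁻ μ in Ioo (0 : ℝ) T,
      ENNReal.ofReal ((iteratedDeriv i (fun t => t ^ (-j) * q t) μ) ^ 2))
    (fun _ _ => zero_le) (by simp)
  simp only [iteratedDeriv_zero] at this
  exact this

lemma lintegral_diagonalEnergy_le {T ε K : ℝ} {κ : ℝ → ℝ} {W Wm Wn X : ℝ × ℝ → ℝ}
    (hW : HasMixedPartials T W Wm Wn X)
    (hdiag : ∀ t ∈ Ioo 0 T, HasDerivAt (fun t => W (t, t)) (Wm (t, t) + Wn (t, t)) t)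
    (hTε : T ≤ ε) (hK : 0 ≤ K) (hκ : ∀ t ∈ Ioo 0 T, κ t ≤ K) :
    ∫⁻ t in Ioo 0 T, ENNReal.ofReal (diagonalEnergy κ W Wm Wn t)
      ≤ ENNReal.ofReal (24 + K + 8 * ε ^ 2) *
        (sobNormSq T 2 2 (fun t => W (t, t))
          + sobNormSq T 2 2 (fun t => deriv (fun a => W (a, t)) t)) := by
  have hpow : ∀ t : ℝ, 0 < t → t ^ (-2 : ℝ) = (t ^ 2)⁻¹ := fun t ht => by
    rw [Real.rpow_neg ht.le, Real.rpow_ofNat]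
  have hr : ∀ t ∈ Ioo 0 T, HasDerivAt (fun t => t ^ (-2 : ℝ) * W (t, t))
      ((t ^ 2)⁻¹ * (Wm (t, t) + Wn (t, t)) - 2 * (t ^ 3)⁻¹ * W (t, t)) t := by
    intro t ht
    have ht0 : t ≠ 0 := ht.1.ne'
    have h := (((hasDerivAt_id t).pow 2).inv (pow_ne_zero 2 ht0)).mul (hdiag t ht)
    refine (h.congr_of_eventuallyEq ?_).congr_deriv ?_
    · filter_upwards [Ioi_mem_nhds ht.1] with x hx
      simp [hpow x hx]
    · simp only [id, Pi.inv_apply, Pi.pow_apply]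
      field_simp
      ring
  have hrc : ContinuousOn (fun t => t ^ (-2 : ℝ) * W (t, t)) (Ioo 0 T) :=
    fun t ht => (hr t ht).continuousAt.continuousWithinAt
  have hpt : ∀ t ∈ Ioo 0 T, ENNReal.ofReal (diagonalEnergy κ W Wm Wn t)
      ≤ ENNReal.ofReal (24 + K + 8 * ε ^ 2) * ((ENNReal.ofReal ((t ^ (-2 : ℝ) * W (t, t)) ^ 2)
        + ENNReal.ofReal ((deriv (fun t => t ^ (-2 : ℝ) * W (t, t)) t) ^ 2))
        + ENNReal.ofReal ((t ^ (-2 : ℝ) * deriv (fun a => W (a, t)) t) ^ 2)) := by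
    intro t ht
    have ht0 : 0 < t := ht.1
    rw [← ENNReal.ofReal_add (sq_nonneg _) (sq_nonneg _),
      ← ENNReal.ofReal_add (by positivity) (sq_nonneg _), ← ENNReal.ofReal_mul (by positivity)]
    refine ENNReal.ofReal_le_ofReal ((diagonalEnergy_le (r := t ^ (-2 : ℝ) * W (t, t))
      (r' := deriv (fun t => t ^ (-2 : ℝ) * W (t, t)) t)
      (ρ := t ^ (-2 : ℝ) * deriv (fun a => W (a, t)) t) ht (hκ t ht) ?_ ?_ ?_).trans ?_)
    · rw [hpow t ht0]; field_simp
    · rw [hpow t ht0, (hW.fst t ht t ht).deriv]; field_simp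
    · rw [(hr t ht).deriv, hpow t ht0, (hW.fst t ht t ht).deriv]; field_simp; ring
    · have hsq : T ^ 2 ≤ ε ^ 2 := pow_le_pow_left₀ (ht0.trans ht.2).le hTε 2
      generalize t ^ (-2 : ℝ) * W (t, t) = r
      generalize deriv (fun t => t ^ (-2 : ℝ) * W (t, t)) t = r'
      generalize t ^ (-2 : ℝ) * deriv (fun a => W (a, t)) t = ρ
      have h1 : 24 + K ≤ 24 + K + 8 * ε ^ 2 := by nlinarith [sq_nonneg ε]
      have h2 : 6 * T ^ 2 ≤ 24 + K + 8 * ε ^ 2 := by nlinarith [sq_nonneg ε]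
      have h3 : 8 * T ^ 2 ≤ 24 + K + 8 * ε ^ 2 := by nlinarith [sq_nonneg ε]
      rw [mul_add, mul_add]
      gcongr
  refine (setLIntegral_mono' measurableSet_Ioo hpt).trans ?_
  rw [lintegral_const_mul' _ _ ENNReal.ofReal_ne_top, lintegral_add_left']
  · gcongr
    · exact lintegral_add_deriv_sq_le_sobNormSq hrc
    · exact lintegral_sq_le_sobNormSq 2 _
  · exact ((hrc.pow 2).aemeasurable measurableSet_Ioo).ennreal_ofReal.add
      ((measurable_deriv _).pow_const 2).ennreal_ofReal.aemeasurable

lemma exists_potential_bounds {ε : ℝ} (hε : 0 < ε) {κ : ℝ → ℝ}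
    (hκ : ContDiffOn ℝ 1 κ (Ico 0 ε)) :
    ∃ (κ' : ℝ → ℝ) (K M : ℝ), 0 ≤ K ∧ 0 ≤ M ∧ ContinuousOn κ' (Ioo 0 (ε / 2)) ∧
      ∀ x ∈ Ioo 0 (ε / 2), HasDerivAt κ (κ' x) x ∧ κ x ≤ K ∧ |κ' x| ≤ M := by
  have hsub : Icc 0 (ε / 2) ⊆ Ico 0 ε := Icc_subset_Ico_right (by linarith)
  have hc' := hκ.continuousOn_derivWithin (uniqueDiffOn_Ico 0 ε) le_rfl
  obtain ⟨K, hK⟩ := isCompact_Icc.exists_bound_of_continuousOn (hκ.continuousOn.mono hsub)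
  obtain ⟨M, hM⟩ := isCompact_Icc.exists_bound_of_continuousOn (hc'.mono hsub)
  have h0 : (0 : ℝ) ∈ Icc 0 (ε / 2) := ⟨le_rfl, by linarith⟩
  refine ⟨derivWithin κ (Ico 0 ε), K, M, (norm_nonneg _).trans (hK 0 h0),
    (norm_nonneg _).trans (hM 0 h0), hc'.mono (Ioo_subset_Icc_self.trans hsub), fun x hx => ?_⟩
  have hx' := Ioo_subset_Icc_self hx
  refine ⟨?_, (le_abs_self _).trans (hK x hx'), hM x hx'⟩
  exact ((hκ.differentiableOn one_ne_zero x (hsub hx')).hasDerivWithinAt).hasDerivAt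
    (Ico_mem_nhds hx.1 (by linarith [hx.2]))

lemma srcNormSq_eq_of_eqOn {T : ℝ} {G : ℝ → ℝ → ℝ} {g : ℝ × ℝ → ℝ}
    (h : ∀ p ∈ Ioo 0 T ×ˢ Ioo 0 T, g p = G p.1 p.2) :
    ∫⁻ p in Ioo 0 T ×ˢ Ioo 0 T, ENNReal.ofReal (16 * (g p ^ 2 / (p.1 + p.2) ^ 5))
      = 16 * srcNormSq T (5 / 2) G := by
  rw [srcNormSq, ← lintegral_const_mul' _ _ (by norm_num)]
  refine setLIntegral_congr_fun (measurableSet_Ioo.prod measurableSet_Ioo) fun p hp => ?_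
  have hs : 0 < p.1 + p.2 := add_pos hp.1.1 hp.2.1
  have e : (p.1 + p.2) ^ (-(2 * (5 / 2)) : ℝ) = ((p.1 + p.2) ^ 5)⁻¹ := by
    rw [Real.rpow_neg hs.le]
    norm_num
  simp only [h p hp, e]
  rw [ENNReal.ofReal_mul (by norm_num), ENNReal.ofReal_ofNat, div_eq_inv_mul]

/-- scalar (eigenfunction-mode) weighted estimate for
`(μ+ν)² ∂_μ∂_ν W − (λ φ(2μν/(μ+ν)) + B(2μν/(μ+ν))) W = G`:
`∫_{Ω_T} (μ+ν)^{-4}(λ+1) W² ≤ C (‖q₁‖_{2,2}² + ‖q₂‖_{2,2}² + |||G|||_{0,5/2}² + |||G|||_{0,2}²)`. -/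
theorem stmt9 (ε : ℝ) (hε : 0 < ε) (φ B : ℝ → ℝ)
    (hφ : ContDiffOn ℝ (⊤ : ℕ∞) φ (Ico 0 ε)) (hB : ContDiffOn ℝ (⊤ : ℕ∞) B (Ico 0 ε))
    (lam c₀ : ℝ) (hlam : 0 ≤ lam) (hc₀ : 0 < c₀)
    (hφpos : ∀ x ∈ Ico (0 : ℝ) ε, 0 < φ x)
    (hcoer : ∀ x ∈ Ico (0 : ℝ) ε, c₀ ≤ lam * φ x + B x) :
    ∃ T₀ C : ℝ, 0 < T₀ ∧ T₀ ≤ ε / 2 ∧ 0 < C ∧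
      ∀ T : ℝ, 0 < T → T ≤ T₀ →
      ∀ G : ℝ → ℝ → ℝ, Measurable (fun p : ℝ × ℝ => G p.1 p.2) →
        srcNormSq T (5 / 2) G ≠ ⊤ → srcNormSq T 2 G ≠ ⊤ →
      ∀ W : ℝ → ℝ → ℝ,
        ContDiffOn ℝ (⊤ : ℕ∞) (fun p : ℝ × ℝ => W p.1 p.2) (Ioo 0 T ×ˢ Ioo 0 T) →
        (∀ μ ∈ Ioo (0 : ℝ) T, ∀ ν ∈ Ioo (0 : ℝ) T,
          (μ + ν) ^ 2 * deriv (fun a => deriv (fun b => W a b) ν) μ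
            - (lam * φ (2 * μ * ν / (μ + ν)) + B (2 * μ * ν / (μ + ν))) * W μ ν = G μ ν) →
        sobNormSq T 2 2 (fun t => W t t) ≠ ⊤ →
        sobNormSq T 2 2 (fun t => deriv (fun a => W a t) t) ≠ ⊤ →
        (∫⁻ p in Ioo (0 : ℝ) T ×ˢ Ioo (0 : ℝ) T,
            ENNReal.ofReal ((p.1 + p.2) ^ (-4 : ℝ) * (lam + 1) * (W p.1 p.2) ^ 2))
          ≤ ENNReal.ofReal C *
            (sobNormSq T 2 2 (fun t => W t t)
              + sobNormSq T 2 2 (fun t => deriv (fun a => W a t) t)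
              + srcNormSq T (5 / 2) G + srcNormSq T 2 G) := by
  obtain ⟨κ, hκdef⟩ : ∃ κ : ℝ → ℝ, ∀ x, κ x = lam * φ x + B x := ⟨_, fun _ => rfl⟩
  have hκ : ContDiffOn ℝ 1 κ (Ico 0 ε) := by
    have : ContDiffOn ℝ (⊤ : ℕ∞) κ (Ico 0 ε) := by
      rw [funext hκdef]; exact (contDiffOn_const.mul hφ).add hB
    exact this.of_le (by exact_mod_cast le_top)
  obtain ⟨κ', K, M, hK, hM, hκ'c, hbd⟩ := exists_potential_bounds hε hκ
  refine ⟨min (ε / 2) (c₀ / (M + 1)), ε * (lam + 1) / c₀ * (2 * (16 + (24 + K + 8 * ε ^ 2))),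
    lt_min (by positivity) (by positivity), min_le_left _ _, by positivity, ?_⟩
  intro T hT hTT G _ _ _ W hW hEq _ _
  have hTε : T ≤ ε / 2 := hTT.trans (min_le_left _ _)
  have hTM : T * M ≤ c₀ := by
    have h1 : T * (M + 1) ≤ c₀ := (le_div_iff₀ (by positivity)).1 (hTT.trans (min_le_right _ _))
    linarith
  have hsub : Ioo 0 T ⊆ Ioo 0 (ε / 2) := Ioo_subset_Ioo_right hTε
  have hW2 : ContDiffOn ℝ 2 (fun p : ℝ × ℝ => W p.1 p.2) (Ioo 0 T ×ˢ Ioo 0 T) :=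
    hW.of_le (WithTop.coe_le_coe.2 le_top)
  obtain ⟨Wm, Wn, X, hP, hdiag⟩ := hW2.exists_hasMixedPartials
  have hsrc : ∀ p ∈ Ioo 0 T ×ˢ Ioo 0 T, modeSource κ (fun p => W p.1 p.2) X p = G p.1 p.2 := by
    rintro ⟨a, b⟩ ⟨ha, hb⟩
    have hX : deriv (fun a => deriv (fun b => W a b) b) a = X (a, b) := by
      rw [← (hP.fst_snd a ha b hb).deriv]
      refine Filter.EventuallyEq.deriv_eq ?_
      filter_upwards [isOpen_Ioo.mem_nhds ha] with x hx
      exact (hP.snd x hx b hb).deriv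
    rw [← hEq a ha b hb, hX, modeSource, hκdef]
  have main := setLIntegral_square_energy_le hP (fun x hx => (hbd x (hsub hx)).1)
    (hκ'c.mono hsub) hc₀.le
    (fun x hx => (hcoer x ⟨hx.1.le, by linarith [hx.2]⟩).trans_eq (hκdef x).symm)
    (fun x hx => (hbd x (hsub hx)).2.2) hTM
  rw [srcNormSq_eq_of_eqOn hsrc] at main
  have hD := lintegral_diagonalEnergy_le hP hdiag (by linarith : T ≤ ε) hK
    fun t ht => (hbd t (hsub ht)).2.1
  have hpt : ∀ p ∈ Ioo (0 : ℝ) T ×ˢ Ioo (0 : ℝ) T,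
      ENNReal.ofReal ((p.1 + p.2) ^ (-4 : ℝ) * (lam + 1) * (W p.1 p.2) ^ 2)
        ≤ ENNReal.ofReal (ε * (lam + 1) / c₀)
          * ENNReal.ofReal (c₀ * ((W p.1 p.2) ^ 2 / (p.1 + p.2) ^ 5)) := by
    intro p hp
    have hs : 0 < p.1 + p.2 := add_pos hp.1.1 hp.2.1
    have hsε : p.1 + p.2 ≤ ε := by linarith [hp.1.2, hp.2.2]
    rw [← ENNReal.ofReal_mul (by positivity)]
    refine ENNReal.ofReal_le_ofReal ?_
    rw [Real.rpow_neg hs.le, Real.rpow_ofNat]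
    calc ((p.1 + p.2) ^ 4)⁻¹ * (lam + 1) * W p.1 p.2 ^ 2
        = (p.1 + p.2) * ((lam + 1) * (W p.1 p.2 ^ 2 / (p.1 + p.2) ^ 5)) := by field_simp
      _ ≤ ε * ((lam + 1) * (W p.1 p.2 ^ 2 / (p.1 + p.2) ^ 5)) := by gcongr
      _ = _ := by field_simp
  refine (setLIntegral_mono' (measurableSet_Ioo.prod measurableSet_Ioo) hpt).trans ?_
  rw [lintegral_const_mul' _ _ ENNReal.ofReal_ne_top, ENNReal.ofReal_mul (by positivity), mul_assoc]
  gcongr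
  refine main.trans ?_
  rw [ENNReal.ofReal_mul zero_le_two, ENNReal.ofReal_ofNat, mul_assoc]
  gcongr
  rw [ENNReal.ofReal_add (by norm_num) (by positivity), ENNReal.ofReal_ofNat, add_mul]
  refine add_le_add ?_ (hD.trans ?_)
  · exact mul_le_mul' le_rfl (le_add_right le_add_self)
  · exact mul_le_mul' le_rfl (le_add_right le_self_add)
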